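/- Every distribution in M_{3,3} lies in the topological closure (in ℝ⁸) of RBM_{3,2}; that is, M_{3,3} ⊆ closure(RBM_{3,2}). -/

import Mathlib

open Real

/-- A `2 × 2 × 2` real tensor. -/
abbrev Tensor : Type := Fin 2 → Fin 2 → Fin 2 → ℝ

/-- `p` is a probability distribution: nonnegative entries summing to 1 (membership in Δ₇). -/
def isDist (p : Tensor) : Prop :=
  (∀ i j k, 0 ≤ p i j k) ∧ (∑ i, ∑ j, ∑ k, p i j k) = 1

/-- `q` is a nonnegative rank-one `2 × 2 × 2` tensor. -/
def rankOne (q : Tensor) : Prop :=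
  ∃ a b c : Fin 2 → ℝ, (∀ i, 0 ≤ a i) ∧ (∀ i, 0 ≤ b i) ∧ (∀ i, 0 ≤ c i) ∧
    ∀ i j k, q i j k = a i * b j * c k

/-- Membership in the model `RBM_{3,2}`. -/
def inRBM32 (p : Tensor) : Prop :=
  isDist p ∧ ∃ q r s t : Tensor, rankOne q ∧ rankOne r ∧ rankOne s ∧ rankOne t ∧
    ∀ i j k, p i j k = (q i j k + r i j k) * (s i j k + t i j k)

/-- Membership in the mixture model `M_{3,3}`. -/
def inM33 (p : Tensor) : Prop :=
  isDist p ∧ ∃ q r s : Tensor, rankOne q ∧ rankOne r ∧ rankOne s ∧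
    ∀ i j k, p i j k = q i j k + r i j k + s i j k

def C1 (p : Tensor) : Prop :=
  p 0 0 0 * p 0 1 1 ≥ p 0 0 1 * p 0 1 0 ∧ p 1 0 0 * p 1 1 1 ≥ p 1 0 1 * p 1 1 0

def C2 (p : Tensor) : Prop :=
  p 0 0 0 * p 0 1 1 ≤ p 0 0 1 * p 0 1 0 ∧ p 1 0 0 * p 1 1 1 ≤ p 1 0 1 * p 1 1 0

def C3 (p : Tensor) : Prop :=
  p 0 0 0 * p 1 0 1 ≥ p 0 0 1 * p 1 0 0 ∧ p 0 1 0 * p 1 1 1 ≥ p 0 1 1 * p 1 1 0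

def C4 (p : Tensor) : Prop :=
  p 0 0 0 * p 1 0 1 ≤ p 0 0 1 * p 1 0 0 ∧ p 0 1 0 * p 1 1 1 ≤ p 0 1 1 * p 1 1 0

def C5 (p : Tensor) : Prop :=
  p 0 0 0 * p 1 1 0 ≥ p 1 0 0 * p 0 1 0 ∧ p 0 0 1 * p 1 1 1 ≥ p 1 0 1 * p 0 1 1

def C6 (p : Tensor) : Prop :=
  p 0 0 0 * p 1 1 0 ≤ p 1 0 0 * p 0 1 0 ∧ p 0 0 1 * p 1 1 1 ≤ p 1 0 1 * p 0 1 1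

open Topology

/-- The cone of Hadamard products of two tensors of nonnegative rank at most two. -/
def InCone (p : Tensor) : Prop :=
  ∃ q r s t : Tensor, rankOne q ∧ rankOne r ∧ rankOne s ∧ rankOne t ∧
    ∀ i j k, p i j k = (q i j k + r i j k) * (s i j k + t i j k)

theorem rankOne.reindex {q : Tensor} (h : rankOne q) (σ τ υ : Fin 2 → Fin 2) :
    rankOne fun i j k => q (σ i) (τ j) (υ k) := by
  obtain ⟨a, b, c, ha, hb, hc, h⟩ := h
  exact ⟨a ∘ σ, b ∘ τ, c ∘ υ, fun _ => ha _, fun _ => hb _, fun _ => hc _, fun _ _ _ => h _ _ _⟩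

theorem rankOne.swap₁₂ {q : Tensor} (h : rankOne q) : rankOne fun i j k => q j i k := by
  obtain ⟨a, b, c, ha, hb, hc, h⟩ := h
  exact ⟨b, a, c, hb, ha, hc, fun i j k => (h _ _ _).trans (by ring)⟩

theorem rankOne.swap₂₃ {q : Tensor} (h : rankOne q) : rankOne fun i j k => q i k j := by
  obtain ⟨a, b, c, ha, hb, hc, h⟩ := h
  exact ⟨a, c, b, ha, hc, hb, fun i j k => (h _ _ _).trans (by ring)⟩

theorem InCone.reindex {p : Tensor} (h : InCone p) (σ τ υ : Fin 2 → Fin 2) :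
    InCone fun i j k => p (σ i) (τ j) (υ k) := by
  obtain ⟨q, r, s, t, hq, hr, hs, ht, h⟩ := h
  exact ⟨_, _, _, _, hq.reindex σ τ υ, hr.reindex σ τ υ, hs.reindex σ τ υ, ht.reindex σ τ υ,
    fun _ _ _ => h _ _ _⟩

theorem InCone.swap₁₂ {p : Tensor} (h : InCone p) : InCone fun i j k => p j i k := by
  obtain ⟨q, r, s, t, hq, hr, hs, ht, h⟩ := h
  exact ⟨_, _, _, _, hq.swap₁₂, hr.swap₁₂, hs.swap₁₂, ht.swap₁₂, fun _ _ _ => h _ _ _⟩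

theorem InCone.swap₂₃ {p : Tensor} (h : InCone p) : InCone fun i j k => p i k j := by
  obtain ⟨q, r, s, t, hq, hr, hs, ht, h⟩ := h
  exact ⟨_, _, _, _, hq.swap₂₃, hr.swap₂₃, hs.swap₂₃, ht.swap₂₃, fun _ _ _ => h _ _ _⟩

/-- A positive tensor whose two slices both have nonnegative determinant is the product of
`e₀ ⊗ R₀ + e₁ ⊗ R₁`, with `R₀` and `R₁` of rank one, and `1 + x ⊗ e₁ ⊗ e₁`. -/
theorem inCone_of_slices_nonneg {p : Tensor} (hp : ∀ i j k, 0 < p i j k)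
    (h : ∀ i, p i 0 1 * p i 1 0 ≤ p i 0 0 * p i 1 1) : InCone p := by
  have slice : ∀ m : Fin 2, rankOne fun i j k =>
      (![if m = 0 then 1 else 0, if m = 1 then 1 else 0] : Fin 2 → ℝ) i *
        (![1, p m 1 0 / p m 0 0] : Fin 2 → ℝ) j * (![p m 0 0, p m 0 1] : Fin 2 → ℝ) k := by
    intro m
    have := (hp m 0 0).le
    have := (hp m 0 1).le
    have := (hp m 1 0).le
    refine ⟨_, _, _, ?_, ?_, ?_, fun _ _ _ => rfl⟩ <;>
      simp only [Fin.forall_fin_two, Matrix.cons_val_zero, Matrix.cons_val_one] <;>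
      constructor <;> positivity
  refine ⟨_, _, fun _ _ _ => 1, fun i j k =>
    (p i 0 0 * p i 1 1 / (p i 0 1 * p i 1 0) - 1) *
      (![0, 1] : Fin 2 → ℝ) j * (![0, 1] : Fin 2 → ℝ) k, slice 0, slice 1,
    ⟨1, 1, 1, by simp, by simp, by simp, by simp⟩,
    ⟨fun i => p i 0 0 * p i 1 1 / (p i 0 1 * p i 1 0) - 1, _, _, fun i => ?_, ?_, ?_,
      fun _ _ _ => rfl⟩, ?_⟩
  · rw [sub_nonneg, one_le_div (mul_pos (hp _ _ _) (hp _ _ _))]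
    exact h i
  · simp [Fin.forall_fin_two]
  · simp [Fin.forall_fin_two]
  · have h0 := fun i j k => (hp i j k).ne'
    simp only [Fin.forall_fin_two] at h0 ⊢
    obtain ⟨⟨⟨_, _⟩, _, _⟩, ⟨_, _⟩, _, _⟩ := h0
    simp
    refine ⟨⟨?_, ?_⟩, ?_, ?_⟩ <;> field_simp

theorem inCone_of_slices_nonpos {p : Tensor} (hp : ∀ i j k, 0 < p i j k)
    (h : ∀ i, p i 0 0 * p i 1 1 ≤ p i 0 1 * p i 1 0) : InCone p := by
  have := (inCone_of_slices_nonneg (p := fun i j k => p i j (1 - k)) (fun _ _ _ => hp _ _ _)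
    (by simpa using h)).reindex id id (1 - ·)
  simpa using this

/-- The mixture of three product tensors with weights `w` and ratios `α`, `β`, `γ`. -/
def mixture (w α β γ : Fin 3 → ℝ) : Tensor := fun i j k =>
  ∑ n, w n * α n ^ (i : ℕ) * β n ^ (j : ℕ) * γ n ^ (k : ℕ)

section Mixture

variable {w α β γ : Fin 3 → ℝ}

theorem mixture_pos (hw : ∀ n, 0 < w n) (hα : ∀ n, 0 < α n) (hβ : ∀ n, 0 < β n)
    (hγ : ∀ n, 0 < γ n) (i j k : Fin 2) : 0 < mixture w α β γ i j k :=
  Finset.sum_pos (fun n _ => mul_pos (mul_pos (mul_pos (hw n) (pow_pos (hα n) _))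
    (pow_pos (hβ n) _)) (pow_pos (hγ n) _)) Finset.univ_nonempty

theorem mixture_swap₁₂ (w α β γ : Fin 3 → ℝ) (i j k : Fin 2) :
    mixture w β α γ j i k = mixture w α β γ i j k :=
  Finset.sum_congr rfl fun _ _ => by ring

theorem mixture_swap₂₃ (w α β γ : Fin 3 → ℝ) (i j k : Fin 2) :
    mixture w α γ β i k j = mixture w α β γ i j k :=
  Finset.sum_congr rfl fun _ _ => by ring

theorem inCone_mixture_swap₁₂ (h : InCone (mixture w β α γ)) : InCone (mixture w α β γ) := by
  simpa only [mixture_swap₁₂ w α β γ] using h.swap₁₂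

theorem inCone_mixture_swap₂₃ (h : InCone (mixture w α γ β)) : InCone (mixture w α β γ) := by
  simpa only [mixture_swap₂₃ w α β γ] using h.swap₂₃

theorem inCone_mixture_of_flip (hα : ∀ n, 0 < α n)
    (h : InCone (mixture (fun n => w n * α n) (fun n => (α n)⁻¹) β γ)) :
    InCone (mixture w α β γ) := by
  have hflip : ∀ i j k, mixture (fun n => w n * α n) (fun n => (α n)⁻¹) β γ (1 - i) j k =
      mixture w α β γ i j k := by
    intro i j k
    refine Finset.sum_congr rfl fun n _ => ?_
    have := (hα n).ne'
    fin_cases i <;> simp [this]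
  simpa only [hflip, id] using h.reindex (1 - ·) id id

theorem mixture_slice_det (w α β γ : Fin 3 → ℝ) (i : Fin 2) :
    mixture w α β γ i 0 0 * mixture w α β γ i 1 1 -
        mixture w α β γ i 0 1 * mixture w α β γ i 1 0 =
      w 0 * α 0 ^ (i : ℕ) * (w 1 * α 1 ^ (i : ℕ)) * ((β 0 - β 1) * (γ 0 - γ 1)) +
      w 0 * α 0 ^ (i : ℕ) * (w 2 * α 2 ^ (i : ℕ)) * ((β 0 - β 2) * (γ 0 - γ 2)) +
      w 1 * α 1 ^ (i : ℕ) * (w 2 * α 2 ^ (i : ℕ)) * ((β 1 - β 2) * (γ 1 - γ 2)) := by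
  simp only [mixture, Fin.sum_univ_three, Fin.val_zero, Fin.val_one, pow_zero, pow_one]
  ring

theorem inCone_mixture_of_monovary (hw : ∀ n, 0 < w n) (hα : ∀ n, 0 < α n) (hβ : ∀ n, 0 < β n)
    (hγ : ∀ n, 0 < γ n) (h01 : 0 ≤ (β 0 - β 1) * (γ 0 - γ 1))
    (h02 : 0 ≤ (β 0 - β 2) * (γ 0 - γ 2)) (h12 : 0 ≤ (β 1 - β 2) * (γ 1 - γ 2)) :
    InCone (mixture w α β γ) := by
  refine inCone_of_slices_nonneg (mixture_pos hw hα hβ hγ) fun i => ?_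
  rw [← sub_nonneg, mixture_slice_det]
  have hv : ∀ n, 0 ≤ w n * α n ^ (i : ℕ) := fun n => (mul_pos (hw n) (pow_pos (hα n) _)).le
  have := mul_nonneg (mul_nonneg (hv 0) (hv 1)) h01
  have := mul_nonneg (mul_nonneg (hv 0) (hv 2)) h02
  have := mul_nonneg (mul_nonneg (hv 1) (hv 2)) h12
  linarith

/-- The case in which the three orderings of the components have three different middle
elements. -/
theorem inCone_mixture_of_distinct_middles (hw : ∀ n, 0 < w n) (hα : ∀ n, 0 < α n)
    (hβ : ∀ n, 0 < β n) (hγ : ∀ n, 0 < γ n) (hα₁ : α 2 ≤ α 0) (hα₂ : α 0 ≤ α 1)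
    (hβ₁ : β 0 ≤ β 2) (hβ₂ : β 2 ≤ β 1) (hγ₁ : γ 0 ≤ γ 1) (hγ₂ : γ 1 ≤ γ 2) :
    InCone (mixture w α β γ) := by
  rcases le_total (w 2 * (γ 2 - γ 1)) (w 0 * (γ 1 - γ 0)) with h | h
  · refine inCone_of_slices_nonneg (mixture_pos hw hα hβ hγ) fun i => ?_
    rw [← sub_nonneg, mixture_slice_det]
    have hpow : α 2 ^ (i : ℕ) ≤ α 0 ^ (i : ℕ) := pow_le_pow_left₀ (hα 2).le hα₁ _
    have hv : ∀ n, 0 ≤ w n * α n ^ (i : ℕ) := fun n => (mul_pos (hw n) (pow_pos (hα n) _)).le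
    have hle : w 2 * α 2 ^ (i : ℕ) * (γ 2 - γ 1) ≤ w 0 * α 0 ^ (i : ℕ) * (γ 1 - γ 0) := by
      have h₁ := mul_le_mul_of_nonneg_left h (pow_pos (hα 2) (i : ℕ)).le
      have h₂ := mul_le_mul_of_nonneg_right hpow
        (mul_nonneg (hw 0).le (sub_nonneg.2 hγ₁))
      linarith
    have h₃ := mul_le_mul_of_nonneg_left hle (mul_nonneg (hv 1) (sub_nonneg.2 hβ₂))
    have h₄ := mul_nonneg (mul_nonneg (hv 1) (sub_nonneg.2 hβ₁))
      (mul_nonneg (hv 0) (sub_nonneg.2 hγ₁))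
    have h₅ := mul_nonneg (mul_nonneg (hv 0) (hv 2))
      (mul_nonneg (sub_nonneg.2 hβ₁) (sub_nonneg.2 (hγ₁.trans hγ₂)))
    linarith
  · refine inCone_mixture_swap₁₂ (inCone_of_slices_nonpos (mixture_pos hw hβ hα hγ) fun i => ?_)
    rw [← sub_nonpos, mixture_slice_det]
    have hpow : β 0 ^ (i : ℕ) ≤ β 2 ^ (i : ℕ) := pow_le_pow_left₀ (hβ 0).le hβ₁ _
    have hv : ∀ n, 0 ≤ w n * β n ^ (i : ℕ) := fun n => (mul_pos (hw n) (pow_pos (hβ n) _)).le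
    have hle : w 0 * β 0 ^ (i : ℕ) * (γ 1 - γ 0) ≤ w 2 * β 2 ^ (i : ℕ) * (γ 2 - γ 1) := by
      have h₁ := mul_le_mul_of_nonneg_left h (pow_pos (hβ 0) (i : ℕ)).le
      have h₂ := mul_le_mul_of_nonneg_right hpow
        (mul_nonneg (hw 2).le (sub_nonneg.2 hγ₂))
      linarith
    have h₃ := mul_le_mul_of_nonneg_left hle (mul_nonneg (hv 1) (sub_nonneg.2 hα₂))
    have h₄ := mul_nonneg (mul_nonneg (hv 1) (sub_nonneg.2 hα₁))
      (mul_nonneg (hv 2) (sub_nonneg.2 hγ₂))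
    have h₅ := mul_nonneg (mul_nonneg (hv 0) (hv 2))
      (mul_nonneg (sub_nonneg.2 hα₁) (sub_nonneg.2 (hγ₁.trans hγ₂)))
    linarith

theorem inCone_mixture_of_le (hw : ∀ n, 0 < w n) (hα : ∀ n, 0 < α n) (hβ : ∀ n, 0 < β n)
    (hγ : ∀ n, 0 < γ n) (h₁ : α 0 ≤ α 1) (h₂ : β 0 ≤ β 1) (h₃ : γ 0 ≤ γ 1) :
    InCone (mixture w α β γ) := by
  have position : ∀ {δ : Fin 3 → ℝ}, δ 0 ≤ δ 1 →
      δ 2 ≤ δ 0 ∨ (δ 0 ≤ δ 2 ∧ δ 2 ≤ δ 1) ∨ δ 1 ≤ δ 2 := by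
    intro δ _
    rcases le_total (δ 2) (δ 0) with h | h
    · exact .inl h
    · exact .inr ((le_total (δ 2) (δ 1)).imp_left fun h' => ⟨h, h'⟩)
  have mono : ∀ {w α β γ : Fin 3 → ℝ}, (∀ n, 0 < w n) → (∀ n, 0 < α n) → (∀ n, 0 < β n) →
      (∀ n, 0 < γ n) → β 0 ≤ β 1 → γ 0 ≤ γ 1 →
      (β 2 ≤ β 0 ∧ γ 2 ≤ γ 0 ∨ (β 0 ≤ β 2 ∧ β 2 ≤ β 1) ∧ (γ 0 ≤ γ 2 ∧ γ 2 ≤ γ 1) ∨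
        β 1 ≤ β 2 ∧ γ 1 ≤ γ 2) → InCone (mixture w α β γ) := by
    intro w α β γ hw hα hβ hγ hb hc h
    rcases h with ⟨_, _⟩ | ⟨⟨_, _⟩, _, _⟩ | ⟨_, _⟩ <;>
      refine inCone_mixture_of_monovary hw hα hβ hγ ?_ ?_ ?_ <;>
      first
      | exact mul_nonneg (by linarith) (by linarith)
      | exact mul_nonneg_of_nonpos_of_nonpos (by linarith) (by linarith)
  have hβγ := mono hw hα hβ hγ h₂ h₃
  have hαγ := fun h => inCone_mixture_swap₁₂ (mono hw hβ hα hγ h₁ h₃ h)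
  have hαβ := fun h => inCone_mixture_swap₂₃ (inCone_mixture_swap₁₂ (mono hw hγ hα hβ h₁ h₂ h))
  rcases position h₁ with ha | ha | ha <;> rcases position h₂ with hb | hb | hb <;>
    rcases position h₃ with hc | hc | hc <;>
    first
    | exact hβγ (.inl ⟨hb, hc⟩)
    | exact hβγ (.inr (.inl ⟨hb, hc⟩))
    | exact hβγ (.inr (.inr ⟨hb, hc⟩))
    | exact hαγ (.inl ⟨ha, hc⟩)
    | exact hαγ (.inr (.inl ⟨ha, hc⟩))
    | exact hαγ (.inr (.inr ⟨ha, hc⟩))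
    | exact hαβ (.inl ⟨ha, hb⟩)
    | exact hαβ (.inr (.inl ⟨ha, hb⟩))
    | exact hαβ (.inr (.inr ⟨ha, hb⟩))
    | skip
  · exact inCone_mixture_of_distinct_middles hw hα hβ hγ ha h₁ hb.1 hb.2 h₃ hc
  · exact inCone_mixture_swap₂₃
      (inCone_mixture_of_distinct_middles hw hα hγ hβ ha h₁ hc.1 hc.2 h₂ hb)
  · exact inCone_mixture_swap₁₂
      (inCone_mixture_of_distinct_middles hw hβ hα hγ hb h₂ ha.1 ha.2 h₃ hc)
  · exact inCone_mixture_swap₁₂ (inCone_mixture_swap₂₃ (inCone_mixture_swap₁₂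
      (inCone_mixture_swap₂₃ (inCone_mixture_of_distinct_middles hw hγ hα hβ hc h₃ ha.1 ha.2 h₂ hb))))
  · exact inCone_mixture_swap₁₂ (inCone_mixture_swap₂₃
      (inCone_mixture_of_distinct_middles hw hβ hγ hα hb h₂ hc.1 hc.2 h₁ ha))
  · exact inCone_mixture_swap₁₂ (inCone_mixture_swap₂₃ (inCone_mixture_swap₁₂
      (inCone_mixture_of_distinct_middles hw hγ hβ hα hc h₃ hb.1 hb.2 h₁ ha)))

theorem inCone_mixture (hw : ∀ n, 0 < w n) (hα : ∀ n, 0 < α n) (hβ : ∀ n, 0 < β n)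
    (hγ : ∀ n, 0 < γ n) : InCone (mixture w α β γ) := by
  wlog h₁ : α 0 ≤ α 1 generalizing w α
  · exact inCone_mixture_of_flip hα (this (fun n => mul_pos (hw n) (hα n))
      (fun n => inv_pos.2 (hα n)) (inv_anti₀ (hα 1) (not_le.1 h₁).le))
  wlog h₂ : β 0 ≤ β 1 generalizing w β
  · exact inCone_mixture_swap₁₂ (inCone_mixture_of_flip hβ (inCone_mixture_swap₁₂
      (this (fun n => inv_pos.2 (hβ n)) (fun n => mul_pos (hw n) (hβ n))
        (inv_anti₀ (hβ 1) (not_le.1 h₂).le))))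
  wlog h₃ : γ 0 ≤ γ 1 generalizing w γ
  · exact inCone_mixture_swap₂₃ (inCone_mixture_swap₁₂ (inCone_mixture_of_flip hγ
      (inCone_mixture_swap₁₂ (inCone_mixture_swap₂₃
      (this (fun n => inv_pos.2 (hγ n)) (fun n => mul_pos (hw n) (hγ n))
        (inv_anti₀ (hγ 1) (not_le.1 h₃).le))))))
  exact inCone_mixture_of_le hw hα hβ hγ h₁ h₂ h₃

end Mixture

theorem inCone_sum_of_pos {a b c : Fin 3 → Fin 2 → ℝ} (ha : ∀ n i, 0 < a n i)
    (hb : ∀ n i, 0 < b n i) (hc : ∀ n i, 0 < c n i) :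
    InCone fun i j k => ∑ n, a n i * b n j * c n k := by
  have h := inCone_mixture (w := fun n => a n 0 * b n 0 * c n 0)
    (fun n => mul_pos (mul_pos (ha n 0) (hb n 0)) (hc n 0))
    (fun n => div_pos (ha n 1) (ha n 0)) (fun n => div_pos (hb n 1) (hb n 0))
    (fun n => div_pos (hc n 1) (hc n 0))
  convert h using 4 with i j k
  refine Finset.sum_congr rfl fun n _ => ?_
  have hpow : ∀ {u : Fin 2 → ℝ}, 0 < u 0 → ∀ i : Fin 2, u i = u 0 * (u 1 / u 0) ^ (i : ℕ) := by
    intro u hu i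
    fin_cases i <;> simp [mul_div_cancel₀ _ hu.ne']
  rw [hpow (ha n 0) i, hpow (hb n 0) j, hpow (hc n 0) k]
  ring

theorem rankOne.smul {q : Tensor} (h : rankOne q) {x : ℝ} (hx : 0 ≤ x) : rankOne (x • q) := by
  obtain ⟨a, b, c, ha, hb, hc, h⟩ := h
  refine ⟨x • a, b, c, fun i => mul_nonneg hx (ha i), hb, hc, fun i j k => ?_⟩
  simp only [Pi.smul_apply, smul_eq_mul, h]
  ring

theorem InCone.inRBM32_normalize {p : Tensor} (h : InCone p) (hp : ∀ i j k, 0 ≤ p i j k)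
    (hsum : 0 < ∑ i, ∑ j, ∑ k, p i j k) :
    inRBM32 ((∑ i, ∑ j, ∑ k, p i j k)⁻¹ • p) := by
  have hx := (inv_pos.2 hsum).le
  obtain ⟨q, r, s, t, hq, hr, hs, ht, h⟩ := h
  refine ⟨⟨fun i j k => mul_nonneg hx (hp i j k), ?_⟩, _, _, s, t, hq.smul hx, hr.smul hx, hs, ht,
    fun i j k => ?_⟩
  · simp only [Pi.smul_apply, smul_eq_mul, ← Finset.mul_sum]
    exact inv_mul_cancel₀ hsum.ne'
  · simp only [Pi.smul_apply, smul_eq_mul, h]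
    ring

theorem stmt9 : {p : Tensor | inM33 p} ⊆ closure {p : Tensor | inRBM32 p} := by
  rintro p ⟨⟨-, hsum⟩, q, r, s, ⟨a₀, b₀, c₀, ha₀, hb₀, hc₀, hq⟩, ⟨a₁, b₁, c₁, ha₁, hb₁, hc₁, hr⟩,
    ⟨a₂, b₂, c₂, ha₂, hb₂, hc₂, hs⟩, hp⟩
  let a : Fin 3 → Fin 2 → ℝ := ![a₀, a₁, a₂]
  let b : Fin 3 → Fin 2 → ℝ := ![b₀, b₁, b₂]
  let c : Fin 3 → Fin 2 → ℝ := ![c₀, c₁, c₂]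
  have ha : ∀ n i, 0 ≤ a n i := by intro n; fin_cases n <;> assumption
  have hb : ∀ n i, 0 ≤ b n i := by intro n; fin_cases n <;> assumption
  have hc : ∀ n i, 0 ≤ c n i := by intro n; fin_cases n <;> assumption
  let P : ℝ → Tensor := fun ε i j k => ∑ n, (a n i + ε) * (b n j + ε) * (c n k + ε)
  have hP0 : P 0 = p := by
    funext i j k
    simp [P, a, b, c, Fin.sum_univ_three, hp, hq, hr, hs]
  have hP : Continuous P := by fun_prop
  have hlim : Filter.Tendsto (fun ε => (∑ i, ∑ j, ∑ k, P ε i j k)⁻¹ • P ε) (𝓝[>] 0) (𝓝 p) := by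
    have hcont : ContinuousAt (fun ε => (∑ i, ∑ j, ∑ k, P ε i j k)⁻¹ • P ε) 0 := by
      have hsumP : Continuous fun ε => ∑ i, ∑ j, ∑ k, P ε i j k := by fun_prop
      refine ContinuousAt.smul (hsumP.continuousAt.inv₀ ?_) hP.continuousAt
      · rw [hP0, hsum]
        exact one_ne_zero
    have hval := hcont.tendsto
    rw [hP0, hsum, inv_one, one_smul] at hval
    exact hval.mono_left nhdsWithin_le_nhds
  refine mem_closure_of_tendsto hlim (eventually_mem_nhdsWithin.mono fun ε hε => ?_)
  have hε : 0 < ε := hε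
  have hpos : ∀ i j k, 0 < P ε i j k := fun i j k => Finset.sum_pos (fun n _ => mul_pos
    (mul_pos (by linarith [ha n i]) (by linarith [hb n j])) (by linarith [hc n k]))
    Finset.univ_nonempty
  refine InCone.inRBM32_normalize (inCone_sum_of_pos (fun n i => ?_) (fun n i => ?_) fun n i => ?_)
    (fun i j k => (hpos i j k).le) (Finset.sum_pos (fun i _ => Finset.sum_pos (fun j _ =>
      Finset.sum_pos (fun k _ => hpos i j k) Finset.univ_nonempty) Finset.univ_nonempty)
      Finset.univ_nonempty)
  · linarith [ha n i]
  · linarith [hb n i]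
  · linarith [hc n i]
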